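/- arXiv:1812.04719 — 2 statements merged into one kernel-verified Lean document; each statement's English description precedes it below -/
import Mathlib

section
/- Let X_φ, X_θ ∈ ℝ³ be linearly independent with Gram matrix g, let n ∈ ℝ³ be a unit vector orthogonal to both X_φ and X_θ, let u ∈ ℝ³ and ε ∈ ℝ, and let M be the 3×3 space-time metric matrix with M_{αβ} = g_{αβ}, M_{αt} = M_{tα} = ⟨u, X_α⟩, M_{tt} = ε² + ⟨u, u⟩. Then det M = (det g)·(ε² + ⟨u, n⟩²). -/
open scoped RealInnerProductSpace

/-- The 2×2 Gram matrix of the tangent vectors `X 0 = X_φ` and `X 1 = X_θ`. -/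
noncomputable def gram (X : Fin 2 → EuclideanSpace ℝ (Fin 3)) : Matrix (Fin 2) (Fin 2) ℝ :=
  Matrix.of fun α β => ⟪X α, X β⟫

/-- The 3×3 space-time metric matrix: `M_{αβ} = g_{αβ}`, `M_{αt} = M_{tα} = ⟨u, X_α⟩`,
`M_{tt} = ε² + ⟨u, u⟩`. -/
noncomputable def spaceTimeMetric (X : Fin 2 → EuclideanSpace ℝ (Fin 3))
    (u : EuclideanSpace ℝ (Fin 3)) (ε : ℝ) : Matrix (Fin 3) (Fin 3) ℝ :=
  !![⟪X 0, X 0⟫, ⟪X 0, X 1⟫, ⟪u, X 0⟫;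
     ⟪X 1, X 0⟫, ⟪X 1, X 1⟫, ⟪u, X 1⟫;
     ⟪u, X 0⟫, ⟪u, X 1⟫, ε ^ 2 + ⟪u, u⟫]

theorem spaceTime_det_eq_gram_det_mul_normal (X : Fin 2 → EuclideanSpace ℝ (Fin 3))
    (hX : LinearIndependent ℝ X) (n : EuclideanSpace ℝ (Fin 3)) (hn : ‖n‖ = 1)
    (hnX : ∀ α : Fin 2, ⟪n, X α⟫ = 0) (u : EuclideanSpace ℝ (Fin 3)) (ε : ℝ) :
    (spaceTimeMetric X u ε).det = (gram X).det * (ε ^ 2 + ⟪u, n⟫ ^ 2) := by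
  have h0 := hnX 0
  have h1 := hnX 1
  have h2 : ⟪n, n⟫ = 1 := by rw [real_inner_self_eq_norm_sq, hn]; norm_num
  simp only [spaceTimeMetric, gram, Matrix.det_fin_three, Matrix.det_fin_two, Matrix.of_apply,
    Matrix.cons_val, PiLp.inner_apply, Fin.sum_univ_three, RCLike.inner_apply, conj_trivial]
    at h0 h1 h2 ⊢
  generalize X 0 = a at *
  generalize X 1 = b at *
  obtain ⟨k, hk⟩ : ∃ k, k = (a 1 * b 2 - a 2 * b 1) * n 0 + (a 2 * b 0 - a 0 * b 2) * n 1
    + (a 0 * b 1 - a 1 * b 0) * n 2 := ⟨_, rfl⟩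
  have e01 : (a 1 * b 2 - a 2 * b 1) * n 1 = (a 2 * b 0 - a 0 * b 2) * n 0 := by
    linear_combination b 2 * h0 - a 2 * h1
  have e12 : (a 2 * b 0 - a 0 * b 2) * n 2 = (a 0 * b 1 - a 1 * b 0) * n 1 := by
    linear_combination b 0 * h0 - a 0 * h1
  have e20 : (a 0 * b 1 - a 1 * b 0) * n 0 = (a 1 * b 2 - a 2 * b 1) * n 2 := by
    linear_combination b 1 * h0 - a 1 * h1
  have c0 : a 1 * b 2 - a 2 * b 1 = k * n 0 := by
    rw [hk]
    linear_combination -(a 1 * b 2 - a 2 * b 1) * h2 + n 1 * e01 - n 2 * e20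
  have c1 : a 2 * b 0 - a 0 * b 2 = k * n 1 := by
    rw [hk]
    linear_combination -(a 2 * b 0 - a 0 * b 2) * h2 - n 0 * e01 + n 2 * e12
  have c2 : a 0 * b 1 - a 1 * b 0 = k * n 2 := by
    rw [hk]
    linear_combination -(a 0 * b 1 - a 1 * b 0) * h2 - n 1 * e12 + n 0 * e20
  have hd : (a 1 * b 2 - a 2 * b 1) * u 0 + (a 2 * b 0 - a 0 * b 2) * u 1
      + (a 0 * b 1 - a 1 * b 0) * u 2 = k * (n 0 * u 0 + n 1 * u 1 + n 2 * u 2) := by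
    rw [c0, c1, c2]; ring
  have hg : (a 1 * b 2 - a 2 * b 1) ^ 2 + (a 2 * b 0 - a 0 * b 2) ^ 2
      + (a 0 * b 1 - a 1 * b 0) ^ 2 = k ^ 2 := by
    rw [c0, c1, c2]; linear_combination k ^ 2 * h2
  have hd2 := congrArg (fun x => x ^ 2) hd
  simp only at hd2
  linear_combination hd2 - (n 0 * u 0 + n 1 * u 1 + n 2 * u 2) ^ 2 * hg
end

section
/- Let a ≤ b be real numbers, let h > 0 be the grid cell size, and let δ be a check-point spacing with 0 < δ ≤ h. Define the set of check points S = { a + j·δ : j ∈ ℕ, a + j·δ ≤ b } ∪ { b }. Then for every integer k such that the grid cell [k·h, (k+1)·h) intersects [a, b], there exists a check point s ∈ S with s ∈ [k·h, (k+1)·h). -/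
/-- One-dimensional check-point guarantee: if check points are placed in `[a, b]`
starting at `a` with spacing `δ ≤ h` (together with the endpoint `b`), then every
grid cell `[k·h, (k+1)·h)` that intersects `[a, b]` contains a check point. -/
theorem checkPoint_mem_grid_cell (a b h δ : ℝ) (hab : a ≤ b) (hh : 0 < h)
    (hδ : 0 < δ) (hδh : δ ≤ h) (k : ℤ)
    (hk : (Set.Ico ((k : ℝ) * h) ((k + 1 : ℝ) * h) ∩ Set.Icc a b).Nonempty) :
    ∃ s ∈ ({x : ℝ | ∃ j : ℕ, x = a + j * δ ∧ a + j * δ ≤ b} ∪ {b}),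
      s ∈ Set.Ico ((k : ℝ) * h) ((k + 1 : ℝ) * h) := by
  obtain ⟨x, ⟨hx1, hx2⟩, hx3, hx4⟩ := hk
  rcases lt_or_ge b ((k + 1 : ℝ) * h) with hb | hb
  · exact ⟨b, Or.inr rfl, hx1.trans hx4, hb⟩
  rcases le_or_gt ((k : ℝ) * h) a with ha | ha
  · exact ⟨a, Or.inl ⟨0, by simp, by simpa using hab⟩, ha, hx3.trans_lt hx2⟩
  have h0 : 0 ≤ ((k : ℝ) * h - a) / δ := div_nonneg (by linarith) hδ.le
  have h1 := Nat.le_ceil (((k : ℝ) * h - a) / δ)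
  have h2 := Nat.ceil_lt_add_one h0
  generalize ⌈((k : ℝ) * h - a) / δ⌉₊ = j at h1 h2
  rw [div_le_iff₀ hδ] at h1
  rw [← sub_lt_iff_lt_add, lt_div_iff₀ hδ] at h2
  have h3 : a + j * δ < (k + 1 : ℝ) * h := by linarith
  exact ⟨a + j * δ, Or.inl ⟨j, rfl, by linarith⟩, by linarith, h3⟩
end
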